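/- Not every IPSC outcome is reachable by PB-EAR: in the multi-winner instance with 4 unit-weight voters, candidates {w,x,y,z} all of cost 1, k = L = 2, and approvals A_1 = A_2 = {w}, A_3 = {x}, A_4 = {x,y}, the outcome {w,y} satisfies IPSC, but the unique outcome of PB-EAR is {w,x}. -/

import Mathlib

open Finset
open scoped Classical

noncomputable section

/-- Each voter's weak preference relation `pref i` is a total preorder. -/
def TotalPreorder {V C : Type} (pref : V → C → C → Prop) : Prop :=
  (∀ i a b, pref i a b ∨ pref i b a) ∧
  (∀ i a b c, pref i a b → pref i b c → pref i a c)

/-- `nth i j` is voter `i`'s `(j+1)`-th most preferred candidate under a fixed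
tie-breaking: an enumeration of all candidates consistent with `pref i`. -/
def TieBreak {V C : Type} [Fintype C] (pref : V → C → C → Prop) (nth : V → ℕ → C) : Prop :=
  (∀ i c, ∃ j, j < Fintype.card C ∧ nth i j = c) ∧
  (∀ i j j', j ≤ j' → pref i (nth i j) (nth i j'))

/-- `N'` solidly supports `C'`: every voter in `N'` weakly prefers every member of `C'`
to every non-member. -/
def Solid {V C : Type} (pref : V → C → C → Prop) (N' : Finset V) (C' : Finset C) : Prop :=
  ∀ i ∈ N', ∀ c' ∈ C', ∀ c, c ∉ C' → pref i c' c

/-- `P(N',C') = {c : ∃ i ∈ N', c ≿_i c^{(i,|C'|)}}` where `c^{(i,j)} = nth i (j-1)`. -/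
def Pset {V C : Type} [Fintype C] (pref : V → C → C → Prop) (nth : V → ℕ → C)
    (N' : Finset V) (C' : Finset C) : Finset C :=
  Finset.univ.filter fun c => ∃ i ∈ N', pref i c (nth i (C'.card - 1))

/-- total cost of a set of candidates -/
def cost {C : Type} (w : C → ℝ) (S : Finset C) : ℝ := ∑ c ∈ S, w c

/-- Comparative PSC for PB with general (weak) preferences. -/
def CPSC {V C : Type} [Fintype V] [Fintype C] (pref : V → C → C → Prop) (nth : V → ℕ → C)
    (b : V → ℝ) (w : C → ℝ) (L : ℝ) (W : Finset C) : Prop :=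
  ¬ ∃ (N' : Finset V) (C' : Finset C), Solid pref N' C' ∧
      cost w (Pset pref nth N' C' ∩ W) < (∑ i ∈ N', b i) * L / (Fintype.card V : ℝ) ∧
      ∃ C'' ⊆ C', cost w (Pset pref nth N' C' ∩ W) < cost w C'' ∧
        cost w C'' ≤ (∑ i ∈ N', b i) * L / (Fintype.card V : ℝ)

/-- Inclusion PSC for PB with general (weak) preferences. -/
def IPSC {V C : Type} [Fintype V] [Fintype C] (pref : V → C → C → Prop) (nth : V → ℕ → C)
    (b : V → ℝ) (w : C → ℝ) (L : ℝ) (W : Finset C) : Prop :=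
  ¬ ∃ (N' : Finset V) (C' : Finset C), Solid pref N' C' ∧
      cost w (Pset pref nth N' C' ∩ W) < (∑ i ∈ N', b i) * L / (Fintype.card V : ℝ) ∧
      ∃ c ∈ C', c ∉ Pset pref nth N' C' ∩ W ∧
        cost w (insert c (Pset pref nth N' C' ∩ W)) ≤ (∑ i ∈ N', b i) * L / (Fintype.card V : ℝ)

/-- `W` is exhaustive w.r.t. budget limit `L`. -/
def Exhaustive {C : Type} (w : C → ℝ) (L : ℝ) (W : Finset C) : Prop :=
  cost w W ≤ L ∧ ∀ c, c ∉ W → L < cost w (insert c W)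

/-- `W` is a maximal cost outcome w.r.t. budget limit `L`. -/
def MaximalCost {C : Type} (w : C → ℝ) (L : ℝ) (W : Finset C) : Prop :=
  cost w W ≤ L ∧ ∀ C' : Finset C, cost w C' ≤ L → cost w C' ≤ cost w W

/-- dichotomous preferences with approval sets `A i` -/
def Dichotomous {V C : Type} (pref : V → C → C → Prop) (A : V → Finset C) : Prop :=
  ∀ i a c, pref i a c ↔ (a ∈ A i ∨ c ∉ A i)

/-- `⋃_{i ∈ N'} A i` -/
def unionA {V C : Type} [Fintype C] (A : V → Finset C) (N' : Finset V) : Finset C :=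
  Finset.univ.filter fun c => ∃ i ∈ N', c ∈ A i

/-- `⋂_{i ∈ N'} A i` -/
def interA {V C : Type} [Fintype C] (A : V → Finset C) (N' : Finset V) : Finset C :=
  Finset.univ.filter fun c => ∀ i ∈ N', c ∈ A i

/-- State of the PB Expanding Approvals Rule: selected candidates, current voter
weights, and the current rank counter (0-indexed: stage `j` uses each voter's
`j+1` most-preferred candidates). -/
structure EARState (V C : Type) where
  W : Finset C
  wt : V → ℝ
  j : ℕ

/-- At stage `j`, voter `i` approves `c` iff `c ≿_i c^{(i,j+1)}`. -/
def approves {V C : Type} (pref : V → C → C → Prop) (nth : V → ℕ → C)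
    (i : V) (j : ℕ) (c : C) : Prop :=
  pref i c (nth i j)

/-- The set `C*` of unselected candidates whose supporter weight meets the
threshold `n·w(c)/L`. -/
def Cstar {V C : Type} [Fintype V] [Fintype C] (pref : V → C → C → Prop) (nth : V → ℕ → C)
    (w : C → ℝ) (L : ℝ) (s : EARState V C) : Finset C :=
  Finset.univ.filter fun c => c ∉ s.W ∧
    (Fintype.card V : ℝ) * w c / L ≤
      ∑ i ∈ Finset.univ.filter (fun i => approves pref nth i s.j c), s.wt i

/-- One step of PB-EAR, performed only while some further candidate could still be
afforded: either increment the rank counter when `C*` is empty, or select some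
`c* ∈ C*` and reduce the weights of its supporters by a total of `n·w(c*)/L`. -/
inductive EARStep {V C : Type} [Fintype V] [Fintype C] (pref : V → C → C → Prop)
    (nth : V → ℕ → C) (w : C → ℝ) (L : ℝ) : EARState V C → EARState V C → Prop
  | incr (s : EARState V C)
      (hguard : ∃ c ∉ s.W, cost w (insert c s.W) ≤ L)
      (hempty : Cstar pref nth w L s = ∅) :
      EARStep pref nth w L s ⟨s.W, s.wt, s.j + 1⟩
  | select (s : EARState V C) (c : C)
      (hguard : ∃ c' ∉ s.W, cost w (insert c' s.W) ≤ L)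
      (hc : c ∈ Cstar pref nth w L s) (wt' : V → ℝ)
      (hle : ∀ i, wt' i ≤ s.wt i) (hnn : ∀ i, 0 ≤ wt' i)
      (hout : ∀ i, ¬ approves pref nth i s.j c → wt' i = s.wt i)
      (htot : (∑ i, s.wt i) - (∑ i, wt' i) = (Fintype.card V : ℝ) * w c / L) :
      EARStep pref nth w L s ⟨insert c s.W, wt', s.j⟩

/-- approvals: candidates w=0, x=1, y=2, z=3; A_1=A_2={w}, A_3={x}, A_4={x,y} -/
def A8 : Fin 4 → Finset (Fin 4) := ![{0}, {0}, {1}, {1, 2}]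

/-- dichotomous preferences induced by `A8` -/
def pref8 : Fin 4 → Fin 4 → Fin 4 → Prop := fun i a c => a ∈ A8 i ∨ c ∉ A8 i

/-- a tie-breaking for the instance -/
def nth8 : Fin 4 → ℕ → Fin 4 := fun i j =>
  (![![0, 1, 2, 3], ![0, 1, 2, 3], ![1, 0, 2, 3], ![1, 2, 0, 3]] : Fin 4 → Fin 4 → Fin 4) i
    (if j = 0 then 0 else if j = 1 then 1 else if j = 2 then 2 else 3)

lemma pref8_iff (i a c : Fin 4) : pref8 i a c ↔ (a ∈ A8 i ∨ c ∉ A8 i) := Iff.rfl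

lemma mem_A8 (i c : Fin 4) : c ∈ A8 i ↔
    ((i = 0 ∨ i = 1) ∧ c = 0) ∨ (i = 2 ∧ c = 1) ∨ (i = 3 ∧ (c = 1 ∨ c = 2)) := by
  fin_cases i <;> simp [A8]

lemma appr8 (i c : Fin 4) : approves pref8 nth8 i 0 c ↔ c ∈ A8 i := by
  unfold approves
  rw [pref8_iff]
  have : nth8 i 0 ∈ A8 i := by
    rw [mem_A8]; fin_cases i <;> simp [nth8]
  tauto

lemma mem_Cstar8 (s : EARState (Fin 4) (Fin 4)) (hj : s.j = 0) (c : Fin 4) :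
    c ∈ Cstar pref8 nth8 (fun _ => (1 : ℝ)) 2 s ↔ c ∉ s.W ∧
      2 ≤ (if c = 0 then s.wt 0 + s.wt 1 else if c = 1 then s.wt 2 + s.wt 3
        else if c = 2 then s.wt 3 else 0) := by
  unfold Cstar
  simp only [Finset.mem_filter, Finset.mem_univ, true_and, Finset.sum_filter,
    Fin.sum_univ_four, hj, appr8]
  have e : ((Fintype.card (Fin 4) : ℕ) : ℝ) * 1 / 2 = 2 := by norm_num
  rw [e]
  have hc : c = 0 ∨ c = 1 ∨ c = 2 ∨ c = 3 := by fin_cases c <;> simp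
  rcases hc with rfl | rfl | rfl | rfl <;> simp [A8]

/-- invariant of the PB-EAR run -/
def Inv8 (s : EARState (Fin 4) (Fin 4)) : Prop :=
  s.j = 0 ∧
    ((s.W = ∅ ∧ s.wt 0 = 1 ∧ s.wt 1 = 1 ∧ s.wt 2 = 1 ∧ s.wt 3 = 1) ∨
     (s.W = {0} ∧ s.wt 0 = 0 ∧ s.wt 1 = 0 ∧ s.wt 2 = 1 ∧ s.wt 3 = 1) ∨
     (s.W = {1} ∧ s.wt 0 = 1 ∧ s.wt 1 = 1 ∧ s.wt 2 = 0 ∧ s.wt 3 = 0) ∨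
     s.W = {0, 1})

lemma cost8 (S : Finset (Fin 4)) : cost (fun _ => (1 : ℝ)) S = S.card := by
  simp [cost]

lemma guard8 (W : Finset (Fin 4)) (h : ∃ c ∉ W, cost (fun _ => (1 : ℝ)) (insert c W) ≤ 2) :
    W ≠ {0, 1} := by
  rintro rfl
  obtain ⟨c, hc, h⟩ := h
  rw [cost8, Finset.card_insert_of_notMem hc] at h
  norm_num at h

lemma inv8_step (s t : EARState (Fin 4) (Fin 4)) (hs : Inv8 s)
    (h : EARStep pref8 nth8 (fun _ => (1 : ℝ)) 2 s t) : Inv8 t := by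
  obtain ⟨hj, hs⟩ := hs
  cases h with
  | incr hguard hempty =>
    exfalso
    have hW := guard8 s.W (by convert hguard)
    have h0 : (0 : Fin 4) ∉ Cstar pref8 nth8 (fun _ => (1 : ℝ)) 2 s := by simp [hempty]
    have h1 : (1 : Fin 4) ∉ Cstar pref8 nth8 (fun _ => (1 : ℝ)) 2 s := by simp [hempty]
    rw [mem_Cstar8 s hj] at h0 h1
    rcases hs with ⟨hw, a, b, c, d⟩ | ⟨hw, a, b, c, d⟩ | ⟨hw, a, b, c, d⟩ | hw
    · rw [hw, a, b] at h0; norm_num at h0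
    · rw [hw, c, d] at h1; norm_num at h1
    · rw [hw, a, b] at h0; norm_num at h0
    · exact hW hw
  | select c hguard hc wt' hle hnn hout htot =>
    have hW := guard8 s.W (by convert hguard)
    rw [mem_Cstar8 s hj] at hc
    obtain ⟨hcW, hc⟩ := hc
    rw [hj] at hout
    simp only [appr8, mem_A8] at hout
    simp only [Fin.sum_univ_four, Fintype.card_fin] at htot
    norm_num at htot
    have l0 := hle 0
    have l1 := hle 1
    have l2 := hle 2
    have l3 := hle 3
    have n0 := hnn 0
    have n1 := hnn 1
    have n2 := hnn 2
    have n3 := hnn 3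
    refine ⟨hj, ?_⟩
    have hc01 : c = 0 ∨ c = 1 ∨ c = 2 ∨ c = 3 := by fin_cases c <;> simp
    rcases hs with ⟨hw, a, b, e, d⟩ | ⟨hw, a, b, e, d⟩ | ⟨hw, a, b, e, d⟩ | hw
    · rw [a, b, e, d] at hc htot
      rw [a] at l0
      rw [b] at l1
      rw [e] at l2
      rw [d] at l3
      rcases hc01 with rfl | rfl | rfl | rfl
      · have o2 := hout 2 (by simp)
        have o3 := hout 3 (by simp)
        right; left
        refine ⟨by simp [hw], ?_, ?_, ?_, ?_⟩ <;> simp only <;> linarith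
      · have o0 := hout 0 (by simp)
        have o1 := hout 1 (by simp)
        right; right; left
        refine ⟨by simp [hw], ?_, ?_, ?_, ?_⟩ <;> simp only <;> linarith
      · simp at hc
      · simp at hc; norm_num at hc
    · rw [a, b, e, d] at hc
      rcases hc01 with rfl | rfl | rfl | rfl
      · simp [hw] at hcW
      · right; right; right
        ext k; simp [hw]; tauto
      · simp at hc
      · simp at hc; norm_num at hc
    · rw [a, b, e, d] at hc
      rcases hc01 with rfl | rfl | rfl | rfl
      · right; right; right
        ext k; simp [hw]
      · simp [hw] at hcW
      · simp at hc; norm_num at hc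
      · simp at hc; norm_num at hc
    · exact absurd hw hW

lemma ipsc_card (N' : Finset (Fin 4)) (P : Finset (Fin 4))
    (hP : ∀ i ∈ N', ∀ c ∈ A8 i, c ∈ P) :
    N'.card < 2 * ((P ∩ {0, 2}).card + 1) := by
  have h0 : (0 : Fin 4) ∈ N' ∨ (1 : Fin 4) ∈ N' → (0 : Fin 4) ∈ P := by
    rintro (h | h)
    · exact hP _ h _ (by simp [mem_A8])
    · exact hP _ h _ (by simp [mem_A8])
  have h3 : (3 : Fin 4) ∈ N' → (2 : Fin 4) ∈ P := fun h => hP _ h _ (by simp [mem_A8])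
  have hN : N'.card = ∑ i : Fin 4, if i ∈ N' then 1 else 0 := by simp
  have hQ : (P ∩ {0, 2}).card = ∑ i : Fin 4, if i ∈ P ∩ {0, 2} then 1 else 0 := by
    rw [Finset.sum_boole, Finset.filter_mem_eq_inter, Finset.univ_inter]; simp
  rw [hN, hQ, Fin.sum_univ_four, Fin.sum_univ_four]
  simp only [Finset.mem_inter, Finset.mem_insert, Finset.mem_singleton]
  by_cases a : (0 : Fin 4) ∈ N' <;> by_cases b : (1 : Fin 4) ∈ N' <;>
    by_cases c : (2 : Fin 4) ∈ N' <;> by_cases d : (3 : Fin 4) ∈ N' <;>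
    simp [a, b, c, d] at h0 h3 ⊢ <;> (try simp only [h0, h3, if_true]) <;> (try split_ifs) <;> omega

/-- in this multi-winner instance (unit costs and budgets, L = k = 2),
the outcome {w,y} satisfies IPSC but the unique outcome of PB-EAR is {w,x}. -/
theorem ipsc_outcome_not_reachable_by_pbear :
    ∃ nth : Fin 4 → ℕ → Fin 4,
      TotalPreorder pref8 ∧ TieBreak pref8 nth ∧
      IPSC pref8 nth (fun _ => (1 : ℝ)) (fun _ => (1 : ℝ)) 2 ({0, 2} : Finset (Fin 4)) ∧
      (∀ s : EARState (Fin 4) (Fin 4),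
        Relation.ReflTransGen (EARStep pref8 nth (fun _ => (1 : ℝ)) 2)
          ⟨∅, fun _ => (1 : ℝ), 0⟩ s →
        (¬ ∃ c ∉ s.W, cost (fun _ => (1 : ℝ)) (insert c s.W) ≤ 2) →
        s.W = ({0, 1} : Finset (Fin 4))) := by
  refine ⟨nth8, ⟨?_, ?_⟩, ⟨?_, ?_⟩, ?_, ?_⟩
  · intro i a b
    simp only [pref8_iff]; tauto
  · intro i a b c
    simp only [pref8_iff]; tauto
  · intro i c
    have h : ∃ k : Fin 4, nth8 i k = c := by
      revert i c
      unfold nth8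
      decide
    obtain ⟨k, hk⟩ := h
    exact ⟨k, by simp, hk⟩
  · intro i j j' hjj
    rw [pref8_iff, mem_A8, mem_A8]
    unfold nth8
    have hi : i = 0 ∨ i = 1 ∨ i = 2 ∨ i = 3 := by fin_cases i <;> simp
    rcases hi with rfl | rfl | rfl | rfl <;> split_ifs <;> first | omega | simp
  · rintro ⟨N', C', -, -, c, -, hc, hle⟩
    have hc' : c ∉ Pset pref8 nth8 N' C' ∩ {0, 2} := by convert hc
    have hle' : cost (fun _ => (1 : ℝ)) (insert c (Pset pref8 nth8 N' C' ∩ {0, 2})) ≤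
        (∑ i ∈ N', (fun _ => (1 : ℝ)) i) * 2 / (Fintype.card (Fin 4) : ℝ) := by convert hle
    clear hle hc
    rw [cost8, Finset.card_insert_of_notMem hc'] at hle'
    have h := ipsc_card N' (Pset pref8 nth8 N' C') (by
      intro i hi c hc
      simp only [Pset, Finset.mem_filter, Finset.mem_univ, true_and]
      exact ⟨i, hi, Or.inl hc⟩)
    have h' : (N'.card : ℝ) < 2 * (((Pset pref8 nth8 N' C' ∩ {0, 2}).card : ℝ) + 1) := by
      exact_mod_cast h
    simp only [Finset.sum_const, Fintype.card_fin, nsmul_eq_mul] at hle'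
    push_cast at hle'
    linarith
  · intro s hs hend
    have hinv : Inv8 s := by
      clear hend
      induction hs with
      | refl => exact ⟨rfl, Or.inl ⟨rfl, rfl, rfl, rfl, rfl⟩⟩
      | tail _ hstep ih => exact inv8_step _ _ ih hstep
    rcases hinv.2 with ⟨hw, -⟩ | ⟨hw, -⟩ | ⟨hw, -⟩ | hw
    · exact absurd ⟨0, by simp [hw], by rw [cost8, hw]; norm_num⟩ hend
    · exact absurd ⟨1, by simp [hw], by rw [cost8, hw]; norm_num⟩ hend
    · exact absurd ⟨0, by simp [hw], by rw [cost8, hw]; norm_num⟩ hend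
    · exact hw
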